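/- Let f ≥ 0 be a Lebesgue-integrable function on [−π, π) and let ℓ : [−π, π) → ℂ be measurable. Let σ_int² := inf { ∫_{−π}^{π} (|ψ(u) − 1|² + |ℓ(u) ψ(u)|²) f(u) du : ψ ∈ 𝓛° }, where 𝓛° is the closed linear span, in L²(f(u)du), of the functions u ↦ e^{i s u} over integers s with |s| ≥ 1. If ∫_{−π}^{π} du / f(u) < ∞, then σ_int² = ∫_{−π}^{π} (|ℓ(u)|² f(u) / (1 + |ℓ(u)|²)) du + ( ∫_{−π}^{π} du / (1 + |ℓ(u)|²) )² · ( ∫_{−π}^{π} du / ( f(u)(1 + |ℓ(u)|²) ) )^{−1}, and the infimum is attained at the function φ(u) = (c + f(u)) / ( f(u)(1 + |ℓ(u)|²) ) with c = − ( ∫_{−π}^{π} du/(1+|ℓ(u)|²) ) · ( ∫_{−π}^{π} du/( f(u)(1+|ℓ(u)|²) ) )^{−1}. -/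

import Mathlib

open MeasureTheory ENNReal Real

lemma integral_Ico_exp_eq_zero {s : ℤ} (hs : s ≠ 0) :
    ∫ u in Set.Ico (-π) π, Complex.exp (Complex.I * (s : ℂ) * (u : ℂ)) = 0 := by
  have hc : Complex.I * (s : ℂ) ≠ 0 := mul_ne_zero Complex.I_ne_zero (by exact_mod_cast hs)
  rw [integral_Ico_eq_integral_Ioc,
    ← intervalIntegral.integral_of_le (by linarith [pi_pos]), integral_exp_mul_complex hc]
  refine div_eq_zero_iff.2 (.inl (sub_eq_zero.2 ?_))
  rw [Complex.exp_eq_exp_iff_exists_int]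
  exact ⟨s, by push_cast; ring⟩

/-- A function integrable over a period vanishes a.e. if all its Fourier coefficients vanish. -/
lemma ae_eq_zero_of_integral_exp_mul_eq_zero {G : ℝ → ℂ} (hG : IntegrableOn G (Set.Ico (-π) π))
    (h : ∀ n : ℤ, ∫ u in Set.Ico (-π) π, Complex.exp (Complex.I * (n : ℂ) * (u : ℂ)) * G u = 0) :
    ∀ᵐ u ∂volume.restrict (Set.Ico (-π) π), G u = 0 := by
  have : Fact (0 < 2 * π) := ⟨by positivity⟩
  have hint (p : C(AddCircle (2 * π), ℂ)) :
      IntegrableOn (fun u : ℝ => p (u : AddCircle (2 * π)) * G u) (Set.Ico (-π) π) := by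
    refine Integrable.bdd_mul hG (c := ‖p‖) ?_ (.of_forall fun u => p.norm_coe_le_norm _)
    exact (p.continuous.comp (AddCircle.continuous_mk' _)).aestronglyMeasurable
  let T : C(AddCircle (2 * π), ℂ) →L[ℂ] ℂ := LinearMap.mkContinuous
    { toFun := fun p => ∫ u in Set.Ico (-π) π, p (u : AddCircle (2 * π)) * G u
      map_add' := fun p q => by
        simp only [ContinuousMap.add_apply, add_mul]
        exact integral_add (hint p) (hint q)
      map_smul' := fun a p => by
        simp only [ContinuousMap.smul_apply, smul_eq_mul, mul_assoc, RingHom.id_apply]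
        exact integral_const_mul _ _ }
    (∫ u in Set.Ico (-π) π, ‖G u‖) (fun p => by
      refine le_of_le_of_eq (b := ∫ u in Set.Ico (-π) π, ‖p‖ * ‖G u‖) ?_
        ((integral_const_mul _ _).trans (mul_comm _ _))
      refine (norm_integral_le_integral_norm _).trans
        (integral_mono (hint p).norm (hG.norm.const_mul _) fun u => ?_)
      simp only [norm_mul]
      gcongr
      exact p.norm_coe_le_norm _)
  have hT (p : C(AddCircle (2 * π), ℂ)) : T p = 0 := by
    have hle : (Submodule.span ℂ (Set.range (fourier (T := 2 * π)))).topologicalClosure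
        ≤ LinearMap.ker T.toLinearMap := by
      refine Submodule.topologicalClosure_minimal _ (Submodule.span_le.2 ?_) T.isClosed_ker
      rintro _ ⟨n, rfl⟩
      refine Eq.trans ?_ (h n)
      refine integral_congr_ae (.of_forall fun u => ?_)
      simp only [fourier_coe_apply]
      congr 2
      push_cast
      have : (π : ℂ) ≠ 0 := by exact_mod_cast pi_ne_zero
      field_simp
    rw [span_fourier_closure_eq_top] at hle
    exact hle Submodule.mem_top
  have key := isOpen_Ioo.ae_eq_zero_of_integral_contDiff_smul_eq_zero (U := Set.Ioo (-π) π)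
    (μ := volume) (f := G)
    (hG.mono_set Set.Ioo_subset_Ico_self).locallyIntegrableOn fun g hg _ hgU => by
      have hg0 {x : ℝ} (hx : x ∉ Set.Ioo (-π) π) : g x = 0 :=
        image_eq_zero_of_notMem_tsupport fun h => hx (hgU h)
      have hcont : Continuous (AddCircle.liftIco (2 * π) (-π) fun u => (g u : ℂ)) := by
        refine AddCircle.liftIco_continuous ?_
          (Complex.continuous_ofReal.comp hg.continuous).continuousOn
        rw [hg0 (by simp), hg0 (by rintro ⟨-, h⟩; linarith)]
      rw [← hT ⟨_, hcont⟩, ← setIntegral_eq_integral_of_forall_compl_eq_zero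
        (s := Set.Ico (-π) π)]
      · refine setIntegral_congr_fun measurableSet_Ico fun u hu => ?_
        simp only [ContinuousMap.coe_mk]
        rw [AddCircle.liftIco_coe_apply ⟨hu.1, by linarith [hu.2]⟩, Complex.real_smul]
      · intro u hu
        rw [hg0 fun h => hu (Set.Ioo_subset_Ico_self h), zero_smul]
  rw [restrict_Ico_eq_restrict_Ioc, ← restrict_Ioo_eq_restrict_Ioc]
  exact (ae_restrict_iff' measurableSet_Ioo).2 key

/-- An integrable function on a period whose nonzero Fourier coefficients vanish is constant. -/
lemma exists_ae_eq_const_of_integral_exp_mul_eq_zero {G : ℝ → ℂ}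
    (hG : IntegrableOn G (Set.Ico (-π) π))
    (h : ∀ n : ℤ, n ≠ 0 →
      ∫ u in Set.Ico (-π) π, Complex.exp (Complex.I * (n : ℂ) * (u : ℂ)) * G u = 0) :
    ∃ k : ℂ, ∀ᵐ u ∂volume.restrict (Set.Ico (-π) π), G u = k := by
  set k : ℂ := (∫ u in Set.Ico (-π) π, G u) / (2 * π)
  have hk : IntegrableOn (fun _ : ℝ => k) (Set.Ico (-π) π) := integrableOn_const (by simp)
  have hexp {F : ℝ → ℂ} (hF : IntegrableOn F (Set.Ico (-π) π)) (n : ℤ) :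
      IntegrableOn (fun u : ℝ => Complex.exp (Complex.I * (n : ℂ) * (u : ℂ)) * F u)
        (Set.Ico (-π) π) := by
    refine Integrable.bdd_mul hF (c := 1) (by fun_prop) (.of_forall fun u => ?_)
    simp [Complex.norm_exp]
  refine ⟨k, ?_⟩
  have := ae_eq_zero_of_integral_exp_mul_eq_zero (G := fun u => G u - k) (hG.sub hk) fun n => by
    simp only [mul_sub]
    rw [integral_sub (hexp hG n) (hexp hk n), integral_mul_const]
    by_cases hn : n = 0
    · have : (π : ℂ) ≠ 0 := by exact_mod_cast pi_ne_zero
      subst hn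
      simp [k, Measure.real, -Complex.ofReal_ofNat, ENNReal.toReal_ofReal, pi_pos.le]
      field_simp
      ring
    · rw [h n hn, integral_Ico_exp_eq_zero hn, zero_mul, sub_zero]
  filter_upwards [this] with u hu using sub_eq_zero.1 hu

section WithDensity

variable {α : Type*} [MeasurableSpace α] {ν : Measure α} {f : α → ℝ}

lemma integral_withDensity_ofReal (hf : Measurable f) (hf0 : ∀ u, 0 ≤ f u) (g : α → ℂ) :
    ∫ u, g u ∂ν.withDensity (fun u => ENNReal.ofReal (f u)) = ∫ u, (f u : ℂ) * g u ∂ν := by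
  rw [integral_withDensity_eq_integral_toReal_smul hf.ennreal_ofReal (by simp)]
  simp [ENNReal.toReal_ofReal (hf0 _)]

lemma integrable_withDensity_ofReal_iff (hf : Measurable f) (hf0 : ∀ u, 0 ≤ f u) {g : α → ℂ} :
    Integrable g (ν.withDensity (fun u => ENNReal.ofReal (f u))) ↔
      Integrable (fun u => (f u : ℂ) * g u) ν := by
  rw [integrable_withDensity_iff_integrable_smul' hf.ennreal_ofReal (by simp)]
  simp [ENNReal.toReal_ofReal (hf0 _)]

lemma ae_withDensity_ofReal_iff (hf : Measurable f) (hpos : ∀ᵐ u ∂ν, 0 < f u) {p : α → Prop} :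
    (∀ᵐ u ∂ν.withDensity (fun u => ENNReal.ofReal (f u)), p u) ↔ ∀ᵐ u ∂ν, p u := by
  have hac : ν ≪ ν.withDensity (fun u => ENNReal.ofReal (f u)) :=
    withDensity_absolutelyContinuous' hf.ennreal_ofReal.aemeasurable <| by
      filter_upwards [hpos] with u hu using by simpa using hu
  exact ⟨fun h => hac.ae_le h, fun h => (withDensity_absolutelyContinuous _ _).ae_le h⟩

lemma memLp_two_withDensity_ofReal_inv (hf : Measurable f) (hf0 : ∀ u, 0 ≤ f u)
    (hinv : Integrable (fun u => (f u)⁻¹) ν) :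
    MemLp (fun u => ((f u)⁻¹ : ℂ)) 2 (ν.withDensity (fun u => ENNReal.ofReal (f u))) := by
  rw [memLp_two_iff_integrable_sq_norm (by fun_prop),
    integrable_withDensity_iff_integrable_smul' hf.ennreal_ofReal (by simp)]
  refine hinv.congr (.of_forall fun u => ?_)
  rcases (hf0 u).eq_or_lt with h | h
  · simp [← h]
  · simp [ENNReal.toReal_ofReal (hf0 u)]
    field_simp

/-- If `1 / f` is integrable, then functions in `L²(f dν)` are integrable with respect to `ν`. -/
lemma integrable_of_memLp_two_withDensity_ofReal (hf : Measurable f) (hf0 : ∀ u, 0 ≤ f u)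
    (hpos : ∀ᵐ u ∂ν, 0 < f u) (hinv : Integrable (fun u => (f u)⁻¹) ν) {g : α → ℂ}
    (hg : MemLp g 2 (ν.withDensity (fun u => ENNReal.ofReal (f u)))) : Integrable g ν := by
  have := (memLp_two_withDensity_ofReal_inv hf hf0 hinv).integrable_mul hg
  rw [integrable_withDensity_ofReal_iff hf hf0] at this
  refine this.congr ?_
  filter_upwards [hpos] with u hu
  have : (f u : ℂ) ≠ 0 := by exact_mod_cast hu.ne'
  simp [this]

end WithDensity

/-- If `1 / f` is integrable, the closed span in `L²(f du)` of the nonconstant exponentials consists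
of the functions with vanishing integral. -/
lemma mem_closure_span_exp_iff {f : ℝ → ℝ} (hf : Measurable f) (hf0 : ∀ u, 0 ≤ f u)
    (hf_int : IntegrableOn f (Set.Ico (-π) π))
    (hpos : ∀ᵐ u ∂volume.restrict (Set.Ico (-π) π), 0 < f u)
    (hinv : IntegrableOn (fun u => (f u)⁻¹) (Set.Ico (-π) π)) {μ : Measure ℝ}
    (hμ : μ = (volume.restrict (Set.Ico (-π) π)).withDensity (fun u => ENNReal.ofReal (f u)))
    (ψ : Lp ℂ 2 μ) :
    ψ ∈ closure (Submodule.span ℂ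
      {g : Lp ℂ 2 μ | ∃ s : ℤ, 1 ≤ |s| ∧
        (g : ℝ → ℂ) =ᵐ[μ] fun u : ℝ => Complex.exp (Complex.I * (s : ℂ) * (u : ℂ))} :
          Set (Lp ℂ 2 μ)) ↔
    ∫ u in Set.Ico (-π) π, (ψ : ℝ → ℂ) u = 0 := by
  set ν := volume.restrict (Set.Ico (-π) π) with hν
  subst hμ
  set μ := ν.withDensity (fun u => ENNReal.ofReal (f u)) with hμ
  have : IsFiniteMeasure μ := isFiniteMeasure_withDensity_ofReal hf_int.hasFiniteIntegral
  set S : Set (Lp ℂ 2 μ) := {g | ∃ s : ℤ, 1 ≤ |s| ∧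
    (g : ℝ → ℂ) =ᵐ[μ] fun u : ℝ => Complex.exp (Complex.I * (s : ℂ) * (u : ℂ))}
  have hinner (a b : Lp ℂ 2 μ) : inner ℂ a b =
      ∫ u, (f u : ℂ) * ((b : ℝ → ℂ) u * starRingEnd ℂ ((a : ℝ → ℂ) u)) ∂ν := by
    simp only [L2.inner_def, RCLike.inner_apply]
    exact integral_withDensity_ofReal hf hf0 _
  have hexp (s : ℤ) :
      MemLp (fun u : ℝ => Complex.exp (Complex.I * (s : ℂ) * (u : ℂ))) 2 μ :=
    MemLp.of_bound (by fun_prop) 1 (.of_forall fun u => by simp [Complex.norm_exp])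
  have hae {p : ℝ → Prop} : (∀ᵐ u ∂μ, p u) ↔ ∀ᵐ u ∂ν, p u := ae_withDensity_ofReal_iff hf hpos
  have hconj (s : ℤ) (u : ℝ) : starRingEnd ℂ (Complex.exp (Complex.I * (s : ℂ) * (u : ℂ))) =
      Complex.exp (Complex.I * ((-s : ℤ) : ℂ) * (u : ℂ)) := by
    rw [← Complex.exp_conj]
    simp
  rw [← Submodule.topologicalClosure_coe, SetLike.mem_coe,
    ← Submodule.orthogonal_orthogonal_eq_closure, Submodule.mem_orthogonal]
  constructor
  · intro h
    have hw := memLp_two_withDensity_ofReal_inv hf hf0 hinv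
    have hwS : hw.toLp ∈ (Submodule.span ℂ S)ᗮ := by
      suffices hle : Submodule.span ℂ S ≤ (Submodule.span ℂ {hw.toLp})ᗮ from
        (Submodule.mem_orthogonal _ _).2 fun g hg =>
          Submodule.mem_orthogonal_singleton_iff_inner_left.1 (hle hg)
      refine Submodule.span_le.2 ?_
      rintro g ⟨s, hs, hg⟩
      rw [SetLike.mem_coe, Submodule.mem_orthogonal_singleton_iff_inner_right, hinner]
      refine Eq.trans (integral_congr_ae ?_)
        (integral_Ico_exp_eq_zero (s := s) (by rintro rfl; simp at hs))
      filter_upwards [hpos, hae.1 hg, hae.1 hw.coeFn_toLp] with u hu h1 h2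
      have : (f u : ℂ) ≠ 0 := by exact_mod_cast hu.ne'
      rw [h1, h2]
      simp
      field_simp
    rw [← h _ hwS, hinner]
    refine integral_congr_ae ?_
    filter_upwards [hpos, hae.1 hw.coeFn_toLp] with u hu h2
    have : (f u : ℂ) ≠ 0 := by exact_mod_cast hu.ne'
    rw [h2]
    simp
    field_simp
  · intro h g hg
    rw [Submodule.mem_orthogonal] at hg
    have hgint : Integrable (fun u => (f u : ℂ) * (g : ℝ → ℂ) u) ν :=
      (integrable_withDensity_ofReal_iff hf hf0).1 ((Lp.memLp g).integrable one_le_two)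
    obtain ⟨k, hk⟩ := exists_ae_eq_const_of_integral_exp_mul_eq_zero hgint fun n hn => by
      rw [← hg (hexp (-n)).toLp (Submodule.subset_span
        ⟨-n, by rw [abs_neg]; exact Int.one_le_abs hn, (hexp (-n)).coeFn_toLp⟩), hinner]
      refine integral_congr_ae ?_
      filter_upwards [hae.1 (hexp (-n)).coeFn_toLp] with u hu
      rw [hu, hconj, neg_neg]
      ring
    rw [hinner, ← mul_zero (starRingEnd ℂ k), ← h, ← integral_const_mul]
    refine integral_congr_ae ?_
    filter_upwards [hk] with u hu
    rw [← hu, map_mul, Complex.conj_ofReal]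
    ring

lemma weighted_sq_dist_eq {f L x y c : ℝ} (hf : 0 < f) (hL : 0 ≤ L) :
    f * (((x - 1) ^ 2 + y ^ 2) + L * (x ^ 2 + y ^ 2)) =
      (L * f / (1 + L) + c ^ 2 * (f * (1 + L))⁻¹ + 2 * c * (x - (c + f) / (f * (1 + L)))) +
        f * (1 + L) * ((x - (c + f) / (f * (1 + L))) ^ 2 + y ^ 2) := by
  have : 1 + L ≠ 0 := by positivity
  field_simp
  ring

lemma ofReal_integral_le_lintegral_ofReal {α : Type*} [MeasurableSpace α] {ν : Measure α}
    {g : α → ℝ} (hg : Integrable g ν) :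
    ENNReal.ofReal (∫ u, g u ∂ν) ≤ ∫⁻ u, ENNReal.ofReal (g u) ∂ν := by
  refine ENNReal.ofReal_le_of_le_toReal ?_
  rw [integral_eq_lintegral_pos_part_sub_lintegral_neg_part hg]
  exact sub_le_self _ ENNReal.toReal_nonneg



/-- Extended interpolation problem, regular case `∫ du/f(u) < ∞`: explicit formula for the
interpolation error and attainment of the infimum at
`φ(u) = (c + f(u)) / (f(u)(1 + |ℓ(u)|²))` with the explicit constant `c`. -/
theorem interpolation_error_of_reciprocal_convergent
    (f : ℝ → ℝ) (hf_meas : Measurable f) (hf_nonneg : ∀ u, 0 ≤ f u)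
    (hf_int : IntegrableOn f (Set.Ico (-π) π) volume)
    (μ : Measure ℝ)
    (hμ : μ = (volume.restrict (Set.Ico (-π) π)).withDensity (fun u => ENNReal.ofReal (f u)))
    (ℓ : ℝ → ℂ) (hℓ : Measurable ℓ)
    (𝓛₁ : Set (Lp ℂ 2 μ))
    (h𝓛₁ : 𝓛₁ = closure (Submodule.span ℂ
      {g : Lp ℂ 2 μ | ∃ s : ℤ, 1 ≤ |s| ∧
        (g : ℝ → ℂ) =ᵐ[μ] fun u : ℝ => Complex.exp (Complex.I * (s : ℂ) * (u : ℂ))}))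
    (J : Lp ℂ 2 μ → ℝ≥0∞)
    (hJ : ∀ ψ : Lp ℂ 2 μ, J ψ =
      (∫⁻ u, (‖(ψ : ℝ → ℂ) u - 1‖₊ : ℝ≥0∞) ^ 2 ∂μ) +
        ∫⁻ u, (‖ℓ u * (ψ : ℝ → ℂ) u‖₊ : ℝ≥0∞) ^ 2 ∂μ)
    (σsqInt : ℝ≥0∞) (hσsqInt : σsqInt = sInf (J '' 𝓛₁))
    (hconv : ∫⁻ u in Set.Ico (-π) π, (ENNReal.ofReal (f u))⁻¹ ≠ ∞)
    (c : ℝ)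
    (hc : c = -(∫ u in Set.Ico (-π) π, (1 + ‖ℓ u‖ ^ 2)⁻¹) *
      (∫ u in Set.Ico (-π) π, (f u * (1 + ‖ℓ u‖ ^ 2))⁻¹)⁻¹) :
    σsqInt =
      (∫⁻ u in Set.Ico (-π) π, ENNReal.ofReal (‖ℓ u‖ ^ 2 * f u / (1 + ‖ℓ u‖ ^ 2))) +
        (∫⁻ u in Set.Ico (-π) π, ENNReal.ofReal ((1 + ‖ℓ u‖ ^ 2)⁻¹)) ^ 2 *
          (∫⁻ u in Set.Ico (-π) π, ENNReal.ofReal ((f u * (1 + ‖ℓ u‖ ^ 2))⁻¹))⁻¹ ∧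
    ∃ φ : Lp ℂ 2 μ, φ ∈ 𝓛₁ ∧
      (φ : ℝ → ℂ) =ᵐ[μ]
        (fun u : ℝ => (((c + f u) / (f u * (1 + ‖ℓ u‖ ^ 2)) : ℝ) : ℂ)) ∧
      J φ = σsqInt := by
  set ν := volume.restrict (Set.Ico (-π) π) with hν
  have hpos : ∀ᵐ u ∂ν, 0 < f u := by
    filter_upwards [ae_lt_top hf_meas.ennreal_ofReal.inv hconv] with u hu
    simpa using hu
  have hinv : Integrable (fun u => (f u)⁻¹) ν := by
    refine ⟨by fun_prop, ?_⟩
    rw [hasFiniteIntegral_iff_ofReal (.of_forall fun u => inv_nonneg.2 (hf_nonneg u))]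
    refine lt_of_le_of_lt (lintegral_mono_ae ?_) hconv.lt_top
    filter_upwards [hpos] with u hu
    rw [ENNReal.ofReal_inv_of_pos hu]
  have hmem := mem_closure_span_exp_iff hf_meas hf_nonneg hf_int hpos hinv hμ
  rw [← h𝓛₁] at hmem
  have hae {p : ℝ → Prop} : (∀ᵐ u ∂μ, p u) ↔ ∀ᵐ u ∂ν, p u :=
    hμ ▸ ae_withDensity_ofReal_iff hf_meas hpos
  have hμfin : IsFiniteMeasure μ :=
    hμ ▸ isFiniteMeasure_withDensity_ofReal hf_int.hasFiniteIntegral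
  have hD1 (u : ℝ) : 1 ≤ 1 + ‖ℓ u‖ ^ 2 := by simp
  have hD0 (u : ℝ) : 0 < 1 + ‖ℓ u‖ ^ 2 := by positivity
  have hintA : Integrable (fun u => (1 + ‖ℓ u‖ ^ 2)⁻¹) ν := by
    refine Integrable.of_bound (by fun_prop) 1 (.of_forall fun u => ?_)
    rw [norm_of_nonneg (inv_nonneg.2 (hD0 u).le)]
    exact inv_le_one_of_one_le₀ (hD1 u)
  have hintB : Integrable (fun u => (f u * (1 + ‖ℓ u‖ ^ 2))⁻¹) ν := by
    refine hinv.mono' (by fun_prop) ?_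
    filter_upwards [hpos] with u hu
    rw [norm_of_nonneg (by positivity)]
    exact inv_anti₀ hu (le_mul_of_one_le_right hu.le (hD1 u))
  have hint1 : Integrable (fun u => ‖ℓ u‖ ^ 2 * f u / (1 + ‖ℓ u‖ ^ 2)) ν := by
    refine Integrable.mono' hf_int (Measurable.aestronglyMeasurable (by fun_prop))
      (.of_forall fun u => ?_)
    have := hf_nonneg u
    rw [norm_of_nonneg (by positivity), div_le_iff₀ (hD0 u)]
    linarith
  set A := ∫ u, (1 + ‖ℓ u‖ ^ 2)⁻¹ ∂ν with hA
  set B := ∫ u, (f u * (1 + ‖ℓ u‖ ^ 2))⁻¹ ∂ν with hB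
  set P := ∫ u, ‖ℓ u‖ ^ 2 * f u / (1 + ‖ℓ u‖ ^ 2) ∂ν
  have h0B : 0 ≤ᵐ[ν] fun u => (f u * (1 + ‖ℓ u‖ ^ 2))⁻¹ :=
    .of_forall fun u => inv_nonneg.2 (mul_nonneg (hf_nonneg u) (hD0 u).le)
  have hBpos : 0 < B := by
    refine lt_of_le_of_ne (integral_nonneg_of_ae h0B) fun h => ?_
    have hne : NeZero ν := ⟨by
      rw [hν, Ne, Measure.restrict_eq_zero]
      simp [pi_pos]⟩
    obtain ⟨u, hu, hu'⟩ :=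
      (((integral_eq_zero_iff_of_nonneg_ae h0B hintB).1 h.symm).and hpos).exists
    have := inv_pos.2 (mul_pos hu' (hD0 u))
    simp only [Pi.zero_apply] at hu
    exact this.ne' hu
  have hV : (∫⁻ u, ENNReal.ofReal (‖ℓ u‖ ^ 2 * f u / (1 + ‖ℓ u‖ ^ 2)) ∂ν) +
        (∫⁻ u, ENNReal.ofReal ((1 + ‖ℓ u‖ ^ 2)⁻¹) ∂ν) ^ 2 *
          (∫⁻ u, ENNReal.ofReal ((f u * (1 + ‖ℓ u‖ ^ 2))⁻¹) ∂ν)⁻¹ =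
      ENNReal.ofReal (P + c ^ 2 * B) := by
    have h0A : 0 ≤ A := integral_nonneg fun u => inv_nonneg.2 (hD0 u).le
    have h01 (u : ℝ) : 0 ≤ ‖ℓ u‖ ^ 2 * f u / (1 + ‖ℓ u‖ ^ 2) := by
      have := hf_nonneg u
      positivity
    rw [← ofReal_integral_eq_lintegral_ofReal hint1 (.of_forall h01),
      ← ofReal_integral_eq_lintegral_ofReal hintA (.of_forall fun u => inv_nonneg.2 (hD0 u).le),
      ← ofReal_integral_eq_lintegral_ofReal hintB h0B, ← ENNReal.ofReal_inv_of_pos hBpos,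
      ← ENNReal.ofReal_pow h0A, ← ENNReal.ofReal_mul (sq_nonneg A),
      ← ENNReal.ofReal_add (integral_nonneg h01) (by positivity)]
    congr 2
    rw [hc]
    field_simp
  have hJ' (ψ : Lp ℂ 2 μ) : J ψ = ∫⁻ u, ENNReal.ofReal
      (f u * (‖(ψ : ℝ → ℂ) u - 1‖ ^ 2 + ‖ℓ u‖ ^ 2 * ‖(ψ : ℝ → ℂ) u‖ ^ 2)) ∂ν := by
    have hψ : Measurable (ψ : ℝ → ℂ) := (Lp.stronglyMeasurable ψ).measurable
    rw [hJ, ← lintegral_add_left (by fun_prop)]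
    generalize (ψ : ℝ → ℂ) = g at hψ
    rw [hμ, lintegral_withDensity_eq_lintegral_mul _ hf_meas.ennreal_ofReal (by fun_prop)]
    refine lintegral_congr fun u => ?_
    rw [Pi.mul_apply, ENNReal.ofReal_mul (hf_nonneg u), ENNReal.ofReal_add (by positivity)
      (by positivity), ← mul_pow, ← norm_mul, ENNReal.ofReal_pow (norm_nonneg _),
      ENNReal.ofReal_pow (norm_nonneg _)]
    simp only [ofReal_norm, enorm_eq_nnnorm]
  have hexpand (ψ : ℝ → ℂ) : ∀ᵐ u ∂ν,
      f u * (‖ψ u - 1‖ ^ 2 + ‖ℓ u‖ ^ 2 * ‖ψ u‖ ^ 2) =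
      (‖ℓ u‖ ^ 2 * f u / (1 + ‖ℓ u‖ ^ 2) + c ^ 2 * (f u * (1 + ‖ℓ u‖ ^ 2))⁻¹ +
        2 * c * ((ψ u).re - (c + f u) / (f u * (1 + ‖ℓ u‖ ^ 2)))) +
      f u * (1 + ‖ℓ u‖ ^ 2) *
        (((ψ u).re - (c + f u) / (f u * (1 + ‖ℓ u‖ ^ 2))) ^ 2 + (ψ u).im ^ 2) := by
    filter_upwards [hpos] with u hu
    rw [← weighted_sq_dist_eq hu (sq_nonneg ‖ℓ u‖), Complex.sq_norm (ψ u - 1),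
      Complex.sq_norm (ψ u), Complex.normSq_apply, Complex.normSq_apply]
    simp only [Complex.sub_re, Complex.sub_im, Complex.one_re, Complex.one_im]
    ring
  have hsplit : (fun u => (c + f u) / (f u * (1 + ‖ℓ u‖ ^ 2))) =ᵐ[ν]
      fun u => c * (f u * (1 + ‖ℓ u‖ ^ 2))⁻¹ + (1 + ‖ℓ u‖ ^ 2)⁻¹ := by
    filter_upwards [hpos] with u hu
    have := hD0 u
    field_simp
  have hφint : Integrable (fun u => (c + f u) / (f u * (1 + ‖ℓ u‖ ^ 2))) ν :=
    ((hintB.const_mul c).add hintA).congr hsplit.symm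
  have hφ0 : ∫ u, (c + f u) / (f u * (1 + ‖ℓ u‖ ^ 2)) ∂ν = 0 := by
    rw [integral_congr_ae hsplit, integral_add (hintB.const_mul c) hintA, integral_const_mul,
      ← hA, ← hB, hc]
    field_simp
    ring
  have hφLp : MemLp (fun u : ℝ => (((c + f u) / (f u * (1 + ‖ℓ u‖ ^ 2)) : ℝ) : ℂ)) 2 μ := by
    have hw : MemLp (fun u => ((f u)⁻¹ : ℂ)) 2 μ :=
      hμ ▸ memLp_two_withDensity_ofReal_inv hf_meas hf_nonneg hinv
    refine ((hw.const_mul (c : ℂ)).add (memLp_const 1)).mono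
      (Measurable.aestronglyMeasurable (by fun_prop)) (hae.2 ?_)
    filter_upwards [hpos] with u hu
    have h1 : (c : ℂ) * (f u : ℂ)⁻¹ + 1 = (((c + f u) / f u : ℝ) : ℂ) := by
      have : (f u : ℂ) ≠ 0 := by exact_mod_cast hu.ne'
      push_cast
      field_simp
    simp only [Pi.add_apply]
    rw [h1, Complex.norm_real, Complex.norm_real, norm_div, norm_div, norm_of_nonneg hu.le,
      norm_of_nonneg (mul_nonneg hu.le (hD0 u).le)]
    exact div_le_div_of_nonneg_left (norm_nonneg _) hu
      (le_mul_of_one_le_right hu.le (hD1 u))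
  have hlower : ∀ ψ ∈ 𝓛₁, ENNReal.ofReal (P + c ^ 2 * B) ≤ J ψ := by
    intro ψ hψ
    have hψint : Integrable (ψ : ℝ → ℂ) ν :=
      integrable_of_memLp_two_withDensity_ofReal hf_meas hf_nonneg hpos hinv (hμ ▸ Lp.memLp ψ)
    have hre : ∫ u, ((ψ : ℝ → ℂ) u).re ∂ν = 0 := by
      have := integral_re hψint
      simp only [RCLike.re_to_complex] at this
      rw [this, (hmem ψ).1 hψ, Complex.zero_re]
    have hi1 := hint1.add (hintB.const_mul (c ^ 2))
    have hi2 := (hψint.re.sub hφint).const_mul (2 * c)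
    have hval := integral_add hi1 hi2
    rw [integral_const_mul, integral_sub' hψint.re hφint, hφ0] at hval
    simp only [RCLike.re_to_complex] at hval
    rw [hre, integral_add' hint1 (hintB.const_mul _), integral_const_mul, sub_zero, mul_zero,
      add_zero, ← hB] at hval
    rw [← hval, hJ']
    refine (ofReal_integral_le_lintegral_ofReal (hi1.add hi2)).trans (lintegral_mono_ae ?_)
    filter_upwards [hexpand ψ, hpos] with u hu hu'
    rw [hu]
    refine ENNReal.ofReal_le_ofReal (le_add_of_nonneg_right ?_)
    have := hD0 u
    positivity
  have hφmem : hφLp.toLp ∈ 𝓛₁ := by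
    rw [hmem, integral_congr_ae (hae.1 hφLp.coeFn_toLp), integral_complex_ofReal, hφ0,
      Complex.ofReal_zero]
  have hφJ : J hφLp.toLp = ENNReal.ofReal (P + c ^ 2 * B) := by
    have h0 : 0 ≤ᵐ[ν] fun u => ‖ℓ u‖ ^ 2 * f u / (1 + ‖ℓ u‖ ^ 2) +
        c ^ 2 * (f u * (1 + ‖ℓ u‖ ^ 2))⁻¹ := .of_forall fun u => by
      have := hf_nonneg u
      simp only [Pi.zero_apply]
      positivity
    have hval := ofReal_integral_eq_lintegral_ofReal (hint1.add (hintB.const_mul (c ^ 2))) h0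
    rw [integral_add' hint1 (hintB.const_mul _), integral_const_mul, ← hB] at hval
    rw [hval, hJ']
    refine lintegral_congr_ae ?_
    filter_upwards [hexpand hφLp.toLp, hae.1 hφLp.coeFn_toLp] with u h1 h2
    rw [h1, h2, Complex.ofReal_re, Complex.ofReal_im, sub_self]
    simp
  have hσ : σsqInt = ENNReal.ofReal (P + c ^ 2 * B) := by
    rw [hσsqInt]
    refine le_antisymm (hφJ ▸ sInf_le ⟨_, hφmem, rfl⟩) (le_sInf ?_)
    rintro _ ⟨ψ, hψ, rfl⟩
    exact hlower ψ hψ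
  exact ⟨hσ.trans hV.symm, hφLp.toLp, hφmem, hφLp.coeFn_toLp, hφJ.trans hσ.symm⟩
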